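/- arXiv:2406.07173 — 6 statements merged into one kernel-verified Lean document; each statement's English description precedes it below -/
import Mathlib

section
/- Let d ≥ 1 be an integer and let γ < -d/2 be a real number. For every x ∈ ℝ^d the series Σ_{k=0}^∞ (k+1)^γ · ( Σ_{n ∈ ℕ^d, n_1+⋯+n_d = k} Π_{j=1}^d H_{n_j}(x_j)^2 / n_j! ) converges (has finite sum). -/
open scoped BigOperators

/-- The `n`-th probabilists' Hermite polynomial, evaluated at `x : ℝ`. -/
noncomputable def hermiteR (n : ℕ) (x : ℝ) : ℝ :=
  Polynomial.aeval x (Polynomial.hermite n)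

lemma hermiteR_rec (n : ℕ) (x : ℝ) :
    hermiteR (n + 2) x = x * hermiteR (n + 1) x - (n + 1) * hermiteR n x := by
  have key : ∀ m : ℕ, Polynomial.derivative (Polynomial.hermite (m + 1))
      = ((m : Polynomial ℤ) + 1) * Polynomial.hermite m := by
    intro m
    induction m with
    | zero => simp [Polynomial.hermite_succ]
    | succ m ih =>
      rw [Polynomial.hermite_succ (m + 1)]
      have h2 := Polynomial.hermite_succ m
      have h3 : Polynomial.derivative (((m : Polynomial ℤ) + 1) * Polynomial.hermite m)
          = ((m : Polynomial ℤ) + 1) * Polynomial.derivative (Polynomial.hermite m) := by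
        rw [Polynomial.derivative_mul]
        simp
      rw [ih, Polynomial.derivative_sub, Polynomial.derivative_mul, ih, h3,
        Polynomial.derivative_X]
      rw [h2]
      push_cast
      ring
  unfold hermiteR
  rw [Polynomial.hermite_succ (n + 1), key]
  simp

/-- `a_n = H_n² / n!` -/
noncomputable def aH (x : ℝ) (n : ℕ) : ℝ := (hermiteR n x) ^ 2 / (Nat.factorial n : ℝ)

/-- partial sums -/
noncomputable def qH (x : ℝ) (n : ℕ) : ℝ := ∑ i ∈ Finset.range (n + 1), aH x i

lemma aH_nonneg (x : ℝ) (n : ℕ) : 0 ≤ aH x n := by unfold aH; positivity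

lemma qH_nonneg (x : ℝ) (n : ℕ) : 0 ≤ qH x n := Finset.sum_nonneg fun i _ => aH_nonneg x i

lemma qH_succ (x : ℝ) (n : ℕ) : qH x (n + 1) = qH x n + aH x (n + 1) := by
  unfold qH; rw [Finset.sum_range_succ]

lemma qH_eq (x : ℝ) (n : ℕ) : qH x n * (Nat.factorial n : ℝ) =
    hermiteR (n + 1) x ^ 2 - x * hermiteR n x * hermiteR (n + 1) x
      + (n + 1) * hermiteR n x ^ 2 := by
  induction n with
  | zero => simp [qH, aH, hermiteR]; ring
  | succ n ih =>
    have hf : (Nat.factorial n : ℝ) ≠ 0 := by positivity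
    have hn : (n : ℝ) + 1 ≠ 0 := by positivity
    have h : aH x (n + 1) * (Nat.factorial (n + 1) : ℝ) = hermiteR (n + 1) x ^ 2 := by
      unfold aH; field_simp
    rw [qH_succ, add_mul, h, Nat.factorial_succ, hermiteR_rec]
    push_cast
    linear_combination ((n : ℝ) + 1) * ih

lemma qH_lower (x κ : ℝ) (n : ℕ) (hκ : κ < 1)
    (hn : x ^ 2 ≤ 4 * (1 - κ) ^ 2 * (n + 1)) :
    κ * (n + 1) * (aH x n + aH x (n + 1)) ≤ qH x n := by
  have hf : (0 : ℝ) < (Nat.factorial n : ℝ) := by positivity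
  have hn' : (0 : ℝ) < (n : ℝ) + 1 := by positivity
  refine le_of_mul_le_mul_right ?_ hf
  rw [qH_eq]
  have e : κ * (n + 1) * (aH x n + aH x (n + 1)) * (Nat.factorial n : ℝ)
      = κ * ((n + 1) * hermiteR n x ^ 2 + hermiteR (n + 1) x ^ 2) := by
    unfold aH; rw [Nat.factorial_succ]; push_cast; field_simp
  rw [e]
  generalize hermiteR n x = u
  generalize hermiteR (n + 1) x = v
  have hδ : 0 < 1 - κ := by linarith
  obtain ⟨δ, rfl⟩ : ∃ δ, κ = 1 - δ := ⟨1 - κ, by ring⟩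
  simp only [sub_sub_cancel] at hn hδ
  -- discriminant argument
  have h4 : 0 ≤ 4 * δ * (δ * v ^ 2 - x * u * v + δ * (n + 1) * u ^ 2) := by
    nlinarith [sq_nonneg (2 * δ * v - x * u), mul_nonneg (sub_nonneg.2 hn) (sq_nonneg u)]
  have h5 := nonneg_of_mul_nonneg_right h4 (by positivity)
  nlinarith

lemma qH_bound (x t : ℝ) (ht : 1 / 2 < t) (ht1 : t < 1) :
    ∃ C : ℝ, 0 ≤ C ∧ ∀ n : ℕ, aH x n ≤ C * ((n : ℝ) + 1) ^ (t - 1) := by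
  obtain ⟨κ, hκ, hκ1⟩ := exists_between
    (show 1 / (2 * t) < 1 by rw [div_lt_one (by linarith)]; linarith)
  have ht0 : 0 < t := by linarith
  have hκ0 : 0 < κ := lt_trans (by positivity) hκ
  have hκt : 1 < 2 * t * κ := by
    rw [div_lt_iff₀ (by positivity)] at hκ; linarith
  -- eventual conditions
  obtain ⟨M, hM⟩ := exists_nat_ge (max (x ^ 2 / (4 * (1 - κ) ^ 2)) (1 / (2 * t * κ - 1)))
  have hM1 : x ^ 2 / (4 * (1 - κ) ^ 2) ≤ M := (le_max_left _ _).trans hM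
  have hM2 : 1 / (2 * t * κ - 1) ≤ M := (le_max_right _ _).trans hM
  have hδ : 0 < 4 * (1 - κ) ^ 2 := by have : 0 < 1 - κ := by linarith
                                      positivity
  have low : ∀ n : ℕ, M ≤ n → κ * (n + 1) * (aH x n + aH x (n + 1)) ≤ qH x n := by
    intro n hn
    have hn' : (M : ℝ) ≤ n := by exact_mod_cast hn
    refine qH_lower x κ n hκ1 ?_
    rw [div_le_iff₀ hδ] at hM1
    nlinarith
  have step : ∀ n : ℕ, M ≤ n → qH x (n + 2) / ((n : ℝ) + 3) ^ t ≤ qH x n / ((n : ℝ) + 1) ^ t := by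
    intro n hn
    have hn' : (M : ℝ) ≤ n := by exact_mod_cast hn
    have hl := low (n + 1) (by omega)
    have e1 := qH_succ x n
    have e2 := qH_succ x (n + 1)
    have a2 := aH_nonneg x (n + 2)
    push_cast at hl
    have h3 : (0 : ℝ) < (n : ℝ) + 3 := by positivity
    have h1 : (0 : ℝ) < (n : ℝ) + 1 := by positivity
    have hm : (n : ℝ) + 3 ≤ 2 * t * (κ * ((n : ℝ) + 2)) := by
      rw [div_le_iff₀ (by linarith)] at hM2
      nlinarith
    have hb : (((n : ℝ) + 1) / ((n : ℝ) + 3)) ^ t ≤ 1 - 2 * t / ((n : ℝ) + 3) := by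
      have := rpow_one_add_le_one_add_mul_self (s := -2 / ((n : ℝ) + 3)) (p := t)
        (by rw [le_div_iff₀ h3]; linarith [(Nat.cast_nonneg n : (0 : ℝ) ≤ n)]) ht0.le ht1.le
      convert this using 1
      · congr 1; field_simp; ring
      · ring
    have hq : qH x (n + 2) * (1 - 2 * t / ((n : ℝ) + 3)) ≤ qH x n := by
      have hq2 := qH_nonneg x (n + 2)
      have hmp : 0 < κ * ((n : ℝ) + 2) := by positivity
      have i1 : aH x (n + 1) + aH x (n + 2) ≤ qH x (n + 2) / (κ * ((n : ℝ) + 2)) := by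
        rw [le_div_iff₀ hmp]
        have : κ * ((n : ℝ) + 1 + 1) = κ * ((n : ℝ) + 2) := by ring
        rw [this] at hl
        linarith
      have i2 : qH x (n + 2) / (κ * ((n : ℝ) + 2)) ≤ qH x (n + 2) * (2 * t / ((n : ℝ) + 3)) := by
        rw [div_eq_mul_inv]
        refine mul_le_mul_of_nonneg_left ?_ hq2
        rw [← one_div, div_le_div_iff₀ hmp h3]
        linarith
      linarith
    rw [div_le_div_iff₀ (by positivity) (by positivity)]
    rw [Real.div_rpow h1.le h3.le, div_le_iff₀ (by positivity)] at hb
    calc qH x (n + 2) * ((n : ℝ) + 1) ^ t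
        ≤ qH x (n + 2) * ((1 - 2 * t / ((n : ℝ) + 3)) * ((n : ℝ) + 3) ^ t) :=
          mul_le_mul_of_nonneg_left hb (qH_nonneg _ _)
      _ = (qH x (n + 2) * (1 - 2 * t / ((n : ℝ) + 3))) * ((n : ℝ) + 3) ^ t := by ring
      _ ≤ _ := mul_le_mul_of_nonneg_right hq (by positivity)
  set U : ℕ → ℝ := fun n => qH x n / ((n : ℝ) + 1) ^ t with hU
  have hU0 : ∀ n, 0 ≤ U n := fun n => div_nonneg (qH_nonneg x n) (by positivity)
  have hUb : ∀ m : ℕ, U (M + m) ≤ U M + U (M + 1) ∧ U (M + m + 1) ≤ U M + U (M + 1) := by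
    intro m
    induction m with
    | zero => exact ⟨by simpa using hU0 (M + 1), by simpa using hU0 M⟩
    | succ m ih =>
      refine ⟨ih.2, le_trans ?_ ih.1⟩
      have := step (M + m) (by omega)
      have e : ((M + (m + 1) + 1 : ℕ) : ℝ) + 1 = ((M + m : ℕ) : ℝ) + 3 := by
        push_cast; ring
      have e' : U (M + (m + 1) + 1) = qH x (M + m + 2) / (((M + m : ℕ) : ℝ) + 3) ^ t := by
        rw [← e]; rfl
      rw [e']
      exact this
  have hB : ∀ n : ℕ, M ≤ n → aH x n ≤ (U M + U (M + 1)) / κ * ((n : ℝ) + 1) ^ (t - 1) := by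
    intro n hn
    obtain ⟨m, rfl⟩ := Nat.exists_eq_add_of_le hn
    have hu := (hUb m).1
    have hl := low (M + m) hn
    have a1 := aH_nonneg x (M + m + 1)
    generalize M + m = n at *
    have h1 : (0 : ℝ) < (n : ℝ) + 1 := by positivity
    simp only [hU] at hu
    rw [div_le_iff₀ (by positivity)] at hu
    rw [Real.rpow_sub_one h1.ne', div_mul_div_comm, le_div_iff₀ (by positivity)]
    have : 0 ≤ κ * ((n : ℝ) + 1) * aH x (n + 1) := by positivity
    simp only [hU]
    linarith
  refine ⟨(U M + U (M + 1)) / κ + ∑ n ∈ Finset.range M, aH x n / ((n : ℝ) + 1) ^ (t - 1), ?_, ?_⟩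
  · have := hU0 M
    have := hU0 (M + 1)
    exact add_nonneg (by positivity)
      (Finset.sum_nonneg fun n _ => div_nonneg (aH_nonneg x n) (by positivity))
  · intro n
    have hp : 0 < ((n : ℝ) + 1) ^ (t - 1) := by positivity
    have hsn : ∀ i ∈ Finset.range M, 0 ≤ aH x i / ((i : ℝ) + 1) ^ (t - 1) :=
      fun n _ => div_nonneg (aH_nonneg x n) (by positivity)
    by_cases hn : M ≤ n
    · refine (hB n hn).trans (mul_le_mul_of_nonneg_right ?_ hp.le)
      linarith [Finset.sum_nonneg hsn]
    · rw [← div_le_iff₀ hp]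
      have := Finset.single_le_sum hsn (Finset.mem_range.2 (by omega : n < M))
      have h0 := hU0 M
      have h1 := hU0 (M + 1)
      have : 0 ≤ (U M + U (M + 1)) / κ := by positivity
      linarith

lemma aH_summable (x s : ℝ) (hs : 1 / 2 < s) :
    Summable (fun n : ℕ => ((n : ℝ) + 1) ^ (-s) * aH x n) := by
  obtain ⟨t, ht, ht2⟩ := exists_between (lt_min hs (by norm_num : (1 / 2 : ℝ) < 1))
  obtain ⟨hts, ht1⟩ := lt_min_iff.1 ht2
  obtain ⟨C, hC, h⟩ := qH_bound x t ht ht1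
  have hsum : Summable (fun n : ℕ => ((n : ℝ) + 1) ^ (t - 1 - s)) := by
    have := (summable_nat_add_iff 1).2
      (Real.summable_nat_rpow.2 (by linarith : t - 1 - s < -1))
    simpa using this
  refine Summable.of_nonneg_of_le (fun n => mul_nonneg (by positivity) (aH_nonneg x n))
    (fun n => ?_) (hsum.mul_left C)
  have hn : (0 : ℝ) < (n : ℝ) + 1 := by positivity
  calc ((n : ℝ) + 1) ^ (-s) * aH x n
      ≤ ((n : ℝ) + 1) ^ (-s) * (C * ((n : ℝ) + 1) ^ (t - 1)) := by
        gcongr; exact h n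
    _ = C * ((n : ℝ) + 1) ^ (t - 1 - s) := by
        rw [sub_eq_add_neg (t - 1) s, Real.rpow_add hn]; ring

/-- Let `d ≥ 1` and `γ < -d/2`.  For every `x ∈ ℝ^d` the series
`Σ_k (k+1)^γ · ( Σ_{n₁+⋯+n_d = k} Π_j H_{n_j}(x_j)² / n_j! )` converges. -/
theorem stmt0 (d : ℕ) (hd : 1 ≤ d) (γ : ℝ) (hγ : γ < -(d : ℝ) / 2) (x : Fin d → ℝ) :
    Summable (fun k : ℕ =>
      ((k : ℝ) + 1) ^ γ *
        ∑ n ∈ Finset.Nat.antidiagonalTuple d k,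
          ∏ j : Fin d, (hermiteR (n j) (x j)) ^ 2 / (Nat.factorial (n j) : ℝ)) := by
  have hd0 : (0 : ℝ) < d := by exact_mod_cast hd
  set s : ℝ := -γ / d with hs
  have hs2 : 1 / 2 < s := by
    rw [hs, lt_div_iff₀ hd0]; linarith
  have hγs : γ = d * (-s) := by rw [hs]; field_simp
  have hS := fun j => aH_summable (x j) s hs2
  have hnn : ∀ (j : Fin d) (n : ℕ), 0 ≤ ((n : ℝ) + 1) ^ (-s) * aH (x j) n :=
    fun j n => mul_nonneg (by positivity) (aH_nonneg _ n)
  refine summable_of_sum_range_le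
    (c := ∏ j : Fin d, ∑' n : ℕ, ((n : ℝ) + 1) ^ (-s) * aH (x j) n) (fun k => ?_) (fun N => ?_)
  · exact mul_nonneg (by positivity)
      (Finset.sum_nonneg fun n _ => Finset.prod_nonneg fun j _ => aH_nonneg (x j) (n j))
  have step : ∀ k ∈ Finset.range N, ((k : ℝ) + 1) ^ γ *
        ∑ n ∈ Finset.Nat.antidiagonalTuple d k,
          ∏ j : Fin d, (hermiteR (n j) (x j)) ^ 2 / (Nat.factorial (n j) : ℝ)
      ≤ ∑ n ∈ Finset.Nat.antidiagonalTuple d k,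
          ∏ j : Fin d, (((n j : ℝ) + 1) ^ (-s) * aH (x j) (n j)) := by
    intro k _
    rw [Finset.mul_sum]
    refine Finset.sum_le_sum fun n hn => ?_
    rw [Finset.prod_mul_distrib]
    refine mul_le_mul_of_nonneg_right ?_ (Finset.prod_nonneg fun j _ => aH_nonneg (x j) (n j))
    rw [Finset.Nat.mem_antidiagonalTuple] at hn
    have e : ((k : ℝ) + 1) ^ γ = ∏ j : Fin d, ((k : ℝ) + 1) ^ (-s) := by
      rw [Finset.prod_const, Finset.card_univ, Fintype.card_fin, ← Real.rpow_mul_natCast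
        (by positivity), hγs, mul_comm]
    rw [e]
    refine Finset.prod_le_prod (fun j _ => by positivity) fun j _ => ?_
    refine Real.rpow_le_rpow_of_nonpos (by positivity) ?_ (by linarith)
    have : n j ≤ k := hn ▸ Finset.single_le_sum (fun i _ => Nat.zero_le (n i)) (Finset.mem_univ j)
    have : (n j : ℝ) ≤ k := by exact_mod_cast this
    linarith
  refine (Finset.sum_le_sum step).trans ?_
  rw [← Finset.sum_biUnion]
  · calc _ ≤ ∑ n ∈ Fintype.piFinset (fun _ : Fin d => Finset.range N),
          ∏ j : Fin d, (((n j : ℝ) + 1) ^ (-s) * aH (x j) (n j)) := by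
          refine Finset.sum_le_sum_of_subset_of_nonneg ?_
            (fun n _ _ => Finset.prod_nonneg fun j _ => hnn j (n j))
          intro n hn
          simp only [Finset.mem_biUnion, Finset.mem_range,
            Finset.Nat.mem_antidiagonalTuple] at hn
          obtain ⟨k, hk, hn⟩ := hn
          simp only [Fintype.mem_piFinset, Finset.mem_range]
          intro j
          have : n j ≤ k :=
            hn ▸ Finset.single_le_sum (fun i _ => Nat.zero_le (n i)) (Finset.mem_univ j)
          omega
      _ = ∏ j : Fin d, ∑ n ∈ Finset.range N, (((n : ℝ) + 1) ^ (-s) * aH (x j) n) := by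
          rw [Finset.prod_univ_sum]
      _ ≤ _ := by
          refine Finset.prod_le_prod (fun j _ => Finset.sum_nonneg fun n _ => hnn j n) fun j _ => ?_
          exact (hS j).sum_le_tsum _ (fun n _ => hnn j n)
  · intro a _ b _ hab
    refine Finset.disjoint_left.2 fun n h1 h2 => hab ?_
    rw [Finset.Nat.mem_antidiagonalTuple] at h1 h2
    rw [← h1, ← h2]
end

section
/- Let d ≥ 1 be an integer and let γ < -d/2 be a real number. Then there exist constants C > 0 and c ∈ (0,1), depending only on γ and d, such that for every t > 0 and every u ∈ ℝ^d: ( Σ_{k=0}^∞ (k+1)^γ Σ_{n ∈ ℕ^d, n_1+⋯+n_d = k} Π_{j=1}^d H_{n_j}(u_j/√t)^2 / n_j! ) · ( p_t^d(u) )² ≤ ( C · p_t^d(c·u) )². -/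
open scoped BigOperators

/-- The `d`-dimensional Gaussian heat kernel `p_t^d(z) = (2πt)^{-d/2} exp(-‖z‖²/(2t))`. -/
noncomputable def heatKernel (d : ℕ) (t : ℝ) (z : EuclideanSpace ℝ (Fin d)) : ℝ :=
  (2 * Real.pi * t) ^ (-(d : ℝ) / 2) * Real.exp (-‖z‖ ^ 2 / (2 * t))

lemma herm_rec (x : ℝ) (n : ℕ) :
    hermiteR (n + 2) x = x * hermiteR (n + 1) x - (n + 1) * hermiteR n x := by
  have key : ∀ n : ℕ, Polynomial.derivative (Polynomial.hermite (n + 1)) =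
      ((n : Polynomial ℤ) + 1) * Polynomial.hermite n := by
    intro n
    induction n with
    | zero => simp
    | succ n ih =>
      rw [Polynomial.hermite_succ (n + 1), Polynomial.derivative_sub, Polynomial.derivative_mul, ih,
        Polynomial.derivative_mul]
      have h1 : Polynomial.derivative ((n : Polynomial ℤ) + 1) = 0 := by simp
      rw [h1, Polynomial.derivative_X, Polynomial.hermite_succ n]
      push_cast
      ring
  unfold hermiteR
  rw [Polynomial.hermite_succ (n + 1), key]
  simp

section oneD

variable {x : ℝ} {H : ℕ → ℝ}

lemma growth (hrec : ∀ n : ℕ, H (n + 2) = x * H (n + 1) - (n + 1) * H n)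
    {ε : ℝ} (hε : 0 < ε) :
    ∃ C, 0 ≤ C ∧ ∀ n, H n ^ 2 / (n.factorial : ℝ) ≤ C * (1 + 2 * ε) ^ n := by
  obtain ⟨N, hN⟩ := exists_nat_gt ((1 + 1 / ε) * x ^ 2 / ε)
  refine ⟨∑ k ∈ Finset.range (N + 2), H k ^ 2 / (k.factorial : ℝ),
    Finset.sum_nonneg fun i _ => by positivity, ?_⟩
  set C := ∑ k ∈ Finset.range (N + 2), H k ^ 2 / (k.factorial : ℝ) with hC
  have hC0 : 0 ≤ C := Finset.sum_nonneg fun i _ => by positivity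
  intro n
  induction n using Nat.strong_induction_on with
  | _ n ih =>
    by_cases hn : n < N + 2
    · have h1 : H n ^ 2 / (n.factorial : ℝ) ≤ C :=
        Finset.single_le_sum (f := fun k => H k ^ 2 / (k.factorial : ℝ))
          (fun i _ => by positivity) (Finset.mem_range.2 hn)
      have h2 : (1 : ℝ) ≤ (1 + 2 * ε) ^ n := one_le_pow₀ (by linarith)
      nlinarith
    · obtain ⟨m, rfl⟩ : ∃ m, n = m + 2 := ⟨n - 2, by omega⟩
      have i0 := ih m (by omega)
      have i1 := ih (m + 1) (by omega)
      have hmN : (N : ℝ) ≤ m := by exact_mod_cast (by omega : N ≤ m)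
      have hm : (1 + 1 / ε) * x ^ 2 ≤ ε * (m + 2) := by
        rw [div_lt_iff₀ hε] at hN
        nlinarith
      set a := H (m + 1) ^ 2 / ((m + 1).factorial : ℝ) with ha
      set b := H m ^ 2 / (m.factorial : ℝ) with hb
      have ha0 : 0 ≤ a := by positivity
      have hb0 : 0 ≤ b := by positivity
      have hf : (0 : ℝ) < m.factorial := by positivity
      have e1 : H (m + 1) ^ 2 = a * ((m + 1) * m.factorial) := by
        rw [ha, Nat.factorial_succ]; push_cast; field_simp
      have e0 : H m ^ 2 = b * m.factorial := by
        rw [hb]; field_simp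
      have hy : (x * H (m + 1) - (m + 1) * H m) ^ 2 ≤
          (1 + 1 / ε) * x ^ 2 * H (m + 1) ^ 2 + (1 + ε) * (m + 1) ^ 2 * H m ^ 2 := by
        have : (1 + 1 / ε) * x ^ 2 * H (m + 1) ^ 2 + (1 + ε) * (m + 1) ^ 2 * H m ^ 2
          - (x * H (m + 1) - (m + 1) * H m) ^ 2
          = (x * H (m + 1) + ε * ((m + 1) * H m)) ^ 2 / ε := by field_simp; ring
        have h2 : 0 ≤ (x * H (m + 1) + ε * ((m + 1) * H m)) ^ 2 / ε := by positivity
        linarith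
      have step : H (m + 2) ^ 2 / ((m + 2).factorial : ℝ) ≤ ε * a + (1 + ε) * b := by
        rw [hrec, div_le_iff₀ (by positivity)]
        refine hy.trans ?_
        rw [e1, e0, Nat.factorial_succ (m + 1), Nat.factorial_succ m]
        push_cast
        have hm0 : (0 : ℝ) ≤ m := by positivity
        have t1 : (1 + 1 / ε) * x ^ 2 * (a * ((m + 1) * m.factorial)) ≤
            ε * (m + 2) * (a * ((m + 1) * m.factorial)) := by gcongr
        have t2 : (1 + ε) * (m + 1) ^ 2 * (b * m.factorial) ≤
            (1 + ε) * ((m + 1) * (m + 2)) * (b * m.factorial) := by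
          gcongr
          nlinarith
        nlinarith
      refine step.trans ?_
      have h3 : (1 + 2 * ε) ^ m ≤ (1 + 2 * ε) ^ (m + 1) :=
        pow_le_pow_right₀ (by linarith) (by omega)
      have h4 : b ≤ C * (1 + 2 * ε) ^ (m + 1) := i0.trans (by gcongr)
      calc ε * a + (1 + ε) * b ≤ ε * (C * (1 + 2 * ε) ^ (m + 1)) +
            (1 + ε) * (C * (1 + 2 * ε) ^ (m + 1)) := by gcongr
        _ = _ := by ring

lemma summDer (hrec : ∀ n : ℕ, H (n + 2) = x * H (n + 1) - (n + 1) * H n)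
    {r : ℝ} (hr0 : 0 ≤ r) (hr : r < 1) :
    Summable (fun n : ℕ => (n : ℝ) * r ^ (n - 1) * (H n ^ 2 / (n.factorial : ℝ))) := by
  obtain ⟨C, hC0, hC⟩ := growth hrec (ε := (1 - r) / 2) (by linarith)
  have hL : (1 + 2 * ((1 - r) / 2)) = 2 - r := by ring
  rw [hL] at hC
  have hq : ‖(2 - r) * r‖ < 1 := by
    rw [Real.norm_of_nonneg (by nlinarith)]
    nlinarith
  have s1 := summable_pow_mul_geometric_of_norm_lt_one 1 hq
  have s0 := summable_pow_mul_geometric_of_norm_lt_one 0 hq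
  rw [← summable_nat_add_iff 1]
  refine Summable.of_nonneg_of_le (fun n => by positivity) (fun n => ?_)
    ((s1.add s0).mul_left (C * (2 - r)))
  have := hC (n + 1)
  calc ((n + 1 : ℕ) : ℝ) * r ^ (n + 1 - 1) * (H (n + 1) ^ 2 / ((n + 1).factorial : ℝ))
      ≤ ((n + 1 : ℕ) : ℝ) * r ^ (n + 1 - 1) * (C * (2 - r) ^ (n + 1)) := by gcongr
    _ = _ := by
      simp only [Nat.add_sub_cancel, mul_pow]
      push_cast
      ring

lemma summ (hrec : ∀ n : ℕ, H (n + 2) = x * H (n + 1) - (n + 1) * H n)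
    {r : ℝ} (hr0 : 0 ≤ r) (hr : r < 1) :
    Summable (fun n : ℕ => r ^ n * (H n ^ 2 / (n.factorial : ℝ))) := by
  rw [← summable_nat_add_iff 1]
  have := (summable_nat_add_iff 1).2 (summDer hrec hr0 hr)
  refine Summable.of_nonneg_of_le (fun n => by positivity) (fun n => ?_) this
  simp only [Nat.add_sub_cancel]
  push_cast
  gcongr
  have : r ^ (n + 1) ≤ r ^ n := pow_le_pow_of_le_one hr0 hr.le (by omega)
  have h2 : 0 ≤ r ^ n := by positivity
  nlinarith [(Nat.cast_nonneg n : (0 : ℝ) ≤ n)]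

/-- The generating function on the diagonal. -/
noncomputable def mehlerA (H : ℕ → ℝ) (r : ℝ) : ℝ :=
  ∑' n : ℕ, r ^ n * (H n ^ 2 / (n.factorial : ℝ))

/-- Its derivative. -/
noncomputable def mehlerDer (H : ℕ → ℝ) (r : ℝ) : ℝ :=
  ∑' n : ℕ, r ^ n * (H (n + 1) ^ 2 / (n.factorial : ℝ))

lemma summDerShift (hrec : ∀ n : ℕ, H (n + 2) = x * H (n + 1) - (n + 1) * H n)
    {r : ℝ} (hr0 : 0 ≤ r) (hr : r < 1) :
    Summable (fun n : ℕ => r ^ n * (H (n + 1) ^ 2 / (n.factorial : ℝ))) := by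
  refine ((summable_nat_add_iff 1).2 (summDer hrec hr0 hr)).congr fun n => ?_
  rw [Nat.factorial_succ, Nat.add_sub_cancel]
  push_cast
  field_simp

lemma mehler_deriv (hrec : ∀ n : ℕ, H (n + 2) = x * H (n + 1) - (n + 1) * H n)
    {r : ℝ} (hr0 : 0 ≤ r) (hr : r < 1) :
    HasDerivAt (mehlerA H) (mehlerDer H r) r := by
  obtain ⟨ρ, h1, h2⟩ := exists_between hr
  have hρ0 : 0 ≤ ρ := by linarith
  have := hasDerivAt_tsum_of_isPreconnected (𝕜 := ℝ) (F := ℝ)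
    (u := fun n : ℕ => (n : ℝ) * ρ ^ (n - 1) * (H n ^ 2 / (n.factorial : ℝ)))
    (g := fun (n : ℕ) (z : ℝ) => z ^ n * (H n ^ 2 / (n.factorial : ℝ)))
    (g' := fun (n : ℕ) (z : ℝ) => (n : ℝ) * z ^ (n - 1) * (H n ^ 2 / (n.factorial : ℝ)))
    (t := Set.Ioo (-ρ) ρ) (y₀ := r) (y := r)
    (summDer hrec hρ0 h2) isOpen_Ioo isPreconnected_Ioo
    (fun n y _ => (hasDerivAt_pow n y).mul_const _)
    (fun n y hy => by
      rw [norm_mul, norm_mul, norm_pow, Real.norm_of_nonneg (Nat.cast_nonneg n),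
        Real.norm_of_nonneg (by positivity : 0 ≤ H n ^ 2 / (n.factorial : ℝ))]
      have : ‖y‖ ≤ ρ := abs_le.2 ⟨hy.1.le, hy.2.le⟩
      gcongr)
    ⟨by linarith, h1⟩ (summ hrec hr0 hr) ⟨by linarith, h1⟩
  refine this.congr_deriv ?_
  rw [(summDer hrec hr0 hr).tsum_eq_zero_add]
  simp only [Nat.cast_zero, zero_mul, zero_add]
  refine tsum_congr fun n => ?_
  rw [Nat.factorial_succ, Nat.add_sub_cancel]
  push_cast
  field_simp

lemma mehler_ode (h0 : H 0 = 1) (h1 : H 1 = x)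
    (hrec : ∀ n : ℕ, H (n + 2) = x * H (n + 1) - (n + 1) * H n)
    {r : ℝ} (hr0 : 0 ≤ r) (hr : r < 1) :
    (1 - r ^ 2) * (1 + r) * mehlerDer H r = (r * (1 + r) + x ^ 2 * (1 - r)) * mehlerA H r := by
  have sa := summ hrec hr0 hr
  have sad := summDerShift hrec hr0 hr
  have sb : Summable (fun n : ℕ => r ^ n * (H (n + 1) * H n / (n.factorial : ℝ))) := by
    refine Summable.of_norm_bounded (sa.add sad) fun n => ?_
    rw [norm_mul, Real.norm_of_nonneg (by positivity : 0 ≤ r ^ n), norm_div,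
      Real.norm_of_nonneg (by positivity : 0 ≤ (n.factorial : ℝ)), ← mul_add, ← add_div]
    gcongr
    rw [Real.norm_eq_abs, abs_le]
    constructor <;> nlinarith [sq_nonneg (H (n + 1) - H n), sq_nonneg (H (n + 1) + H n)]
  have sd : Summable (fun n : ℕ => r ^ n * (H (n + 2) * H n / (n.factorial : ℝ))) := by
    rw [← summable_nat_add_iff 1]
    have := ((((summable_nat_add_iff 1).2 sb).mul_left x).sub ((summable_nat_add_iff 1).2 sa)).sub
      (sad.mul_left r)
    refine this.congr fun n => ?_
    rw [hrec (n + 1), Nat.factorial_succ]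
    push_cast
    field_simp
    ring
  set A := mehlerA H r with hA
  set Ad := mehlerDer H r with hAd
  set B := ∑' n : ℕ, r ^ n * (H (n + 1) * H n / (n.factorial : ℝ)) with hB
  set D := ∑' n : ℕ, r ^ n * (H (n + 2) * H n / (n.factorial : ℝ)) with hD
  have eB : B = x * A - r * B := by
    have : r * B = ∑' n : ℕ, (x * (r ^ (n + 1) * (H (n + 1) ^ 2 / ((n + 1).factorial : ℝ))) -
        r ^ (n + 1) * (H (n + 1 + 1) * H (n + 1) / ((n + 1).factorial : ℝ))) := by
      rw [hB, ← tsum_mul_left]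
      refine tsum_congr fun n => ?_
      rw [hrec n, Nat.factorial_succ]
      push_cast
      field_simp
      ring
    rw [Summable.tsum_sub (((summable_nat_add_iff 1).2 sa).mul_left x)
      ((summable_nat_add_iff 1).2 sb), tsum_mul_left] at this
    have q1 := sa.tsum_eq_zero_add
    have q2 := sb.tsum_eq_zero_add
    change A = _ at q1
    change B = _ at q2
    simp [h0, h1] at q1 q2
    rw [this]
    linear_combination q2 - x * q1
  have eA : Ad = x * B - r * D := by
    have : r * D = ∑' n : ℕ, (x * (r ^ (n + 1) * (H (n + 1 + 1) * H (n + 1) / ((n + 1).factorial : ℝ))) -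
        r ^ (n + 1) * (H (n + 1 + 1) ^ 2 / ((n + 1).factorial : ℝ))) := by
      rw [hD, ← tsum_mul_left]
      refine tsum_congr fun n => ?_
      rw [hrec n, Nat.factorial_succ]
      push_cast
      field_simp
      ring
    rw [Summable.tsum_sub (((summable_nat_add_iff 1).2 sb).mul_left x)
      ((summable_nat_add_iff 1).2 sad), tsum_mul_left] at this
    have q1 := sad.tsum_eq_zero_add
    have q2 := sb.tsum_eq_zero_add
    change Ad = _ at q1
    change B = _ at q2
    simp [h0, h1] at q1 q2
    rw [this]
    linear_combination q1 - x * q2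
  have eD : D = x * B - A - r * Ad := by
    have : r * Ad = ∑' n : ℕ, (x * (r ^ (n + 1) * (H (n + 1 + 1) * H (n + 1) / ((n + 1).factorial : ℝ))) -
        r ^ (n + 1) * (H (n + 1) ^ 2 / ((n + 1).factorial : ℝ)) -
        r ^ (n + 1) * (H (n + 1 + 2) * H (n + 1) / ((n + 1).factorial : ℝ))) := by
      rw [hAd, mehlerDer, ← tsum_mul_left]
      refine tsum_congr fun n => ?_
      rw [hrec (n + 1), Nat.factorial_succ]
      push_cast
      field_simp
      ring
    rw [Summable.tsum_sub ((((summable_nat_add_iff 1).2 sb).mul_left x).sub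
      ((summable_nat_add_iff 1).2 sa)) ((summable_nat_add_iff 1).2 sd),
      Summable.tsum_sub (((summable_nat_add_iff 1).2 sb).mul_left x)
      ((summable_nat_add_iff 1).2 sa), tsum_mul_left] at this
    have q1 := sa.tsum_eq_zero_add
    have q2 := sb.tsum_eq_zero_add
    have q3 := sd.tsum_eq_zero_add
    change A = _ at q1
    change B = _ at q2
    change D = _ at q3
    have h2 := hrec 0
    simp [h0, h1] at h2
    simp [h0, h1, h2] at q1 q2 q3
    rw [this]
    linear_combination q3 - x * q2 + q1
  linear_combination (1 + r) * eA - r * (1 + r) * eD + x * (1 - r) * eB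

lemma mehler_bound (h0 : H 0 = 1) (h1 : H 1 = x)
    (hrec : ∀ n : ℕ, H (n + 2) = x * H (n + 1) - (n + 1) * H n)
    {r : ℝ} (hr0 : 0 ≤ r) (hr : r < 1) :
    mehlerA H r ≤ (1 - r ^ 2) ^ (-(1 : ℝ) / 2) * Real.exp (x ^ 2 / 2) := by
  have hA0 : mehlerA H 0 = 1 := by
    unfold mehlerA
    rw [tsum_eq_single 0]
    · simp [h0]
    · intro n hn; simp [hn]
  set G : ℝ → ℝ := fun s => mehlerA H s ^ 2 * (1 - s ^ 2) * Real.exp (-2 * x ^ 2 * (s / (1 + s)))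
    with hG
  have hd : ∀ s ∈ Set.Icc 0 r, HasDerivAt G 0 s := by
    intro s hs
    have hs1 : 1 + s ≠ 0 := by linarith [hs.1]
    have a1 := mehler_deriv hrec hs.1 (hs.2.trans_lt hr)
    have a2 := mehler_ode h0 h1 hrec hs.1 (hs.2.trans_lt hr)
    have b1 : HasDerivAt (fun s : ℝ => 1 - s ^ 2) (-(2 * s)) s := by
      simpa using (hasDerivAt_pow 2 s).const_sub 1
    have b2 : HasDerivAt (fun s : ℝ => s / (1 + s)) (1 / (1 + s) ^ 2) s := by
      refine ((hasDerivAt_id s).div ((hasDerivAt_id s).const_add 1) hs1).congr_deriv ?_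
      simp
    refine (((a1.pow 2).mul b1).mul (b2.const_mul (-2 * x ^ 2)).exp).congr_deriv ?_
    simp only [Pi.pow_apply, Pi.mul_apply]
    have e : mehlerDer H s * (1 - s ^ 2) = (r * 0 + s + x ^ 2 * (1 - s) / (1 + s)) * mehlerA H s := by
      field_simp
      linear_combination a2
    have e2 : (1 - s ^ 2) * (1 / (1 + s) ^ 2) = (1 - s) / (1 + s) := by field_simp; ring
    push_cast
    linear_combination (2 * mehlerA H s * Real.exp (-2 * x ^ 2 * (s / (1 + s)))) * e -
      2 * x ^ 2 * mehlerA H s ^ 2 * Real.exp (-2 * x ^ 2 * (s / (1 + s))) * e2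
  have hc := constant_of_has_deriv_right_zero (f := G) (a := 0) (b := r)
    (fun s hs => (hd s hs).continuousAt.continuousWithinAt)
    (fun s hs => (hd s ⟨hs.1, hs.2.le⟩).hasDerivWithinAt) r ⟨hr0, le_rfl⟩
  have hpos : 0 < 1 - r ^ 2 := by nlinarith
  have hG1 : mehlerA H r ^ 2 * (1 - r ^ 2) * Real.exp (-2 * x ^ 2 * (r / (1 + r))) = 1 := by
    exact hc.trans (by simp [hG, hA0])
  have hrr : r / (1 + r) ≤ 1 / 2 := by
    rw [div_le_div_iff₀ (by linarith) (by norm_num)]; linarith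
  have he : Real.exp (-x ^ 2) ≤ Real.exp (-2 * x ^ 2 * (r / (1 + r))) := by
    apply Real.exp_le_exp.2
    nlinarith [sq_nonneg x]
  have hle : mehlerA H r ^ 2 * (1 - r ^ 2) * Real.exp (-x ^ 2) ≤ 1 := by
    refine le_trans ?_ hG1.le
    gcongr
  refine le_of_sq_le_sq ?_ (by positivity)
  rw [mul_pow, ← Real.rpow_natCast ((1 - r ^ 2) ^ (-(1 : ℝ) / 2)), ← Real.rpow_mul hpos.le, ← Real.exp_nat_mul]
  have : (-(1 : ℝ) / 2 * ((2 : ℕ) : ℝ)) = -1 := by norm_num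
  rw [this, Real.rpow_neg_one]
  have h3 : ((2 : ℕ) : ℝ) * (x ^ 2 / 2) = x ^ 2 := by push_cast; ring
  rw [h3]
  rw [Real.exp_neg] at hle
  have := Real.exp_pos (x ^ 2)
  rw [← div_eq_mul_inv, div_le_one this] at hle
  rw [inv_mul_eq_div, le_div_iff₀ hpos]
  exact hle

lemma trunc_bound (h0 : H 0 = 1) (h1 : H 1 = x)
    (hrec : ∀ n : ℕ, H (n + 2) = x * H (n + 1) - (n + 1) * H n)
    {r : ℝ} (hr0 : 0 ≤ r) (hr : r < 1) (K : ℕ) :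
    ∑ n ∈ Finset.range K, r ^ n * (H n ^ 2 / (n.factorial : ℝ)) ≤
      (1 - r ^ 2) ^ (-(1 : ℝ) / 2) * Real.exp (x ^ 2 / 2) :=
  ((summ hrec hr0 hr).sum_le_tsum _ (fun i _ => by positivity)).trans
    (mehler_bound h0 h1 hrec hr0 hr)

end oneD

lemma multi_bound (d : ℕ) (y : Fin d → ℝ) {r : ℝ} (hr0 : 0 ≤ r) (hr : r < 1) (K : ℕ) :
    ∑ k ∈ Finset.range K, r ^ k * ∑ n ∈ Finset.Nat.antidiagonalTuple d k,
      ∏ j : Fin d, (hermiteR (n j) (y j)) ^ 2 / (Nat.factorial (n j) : ℝ) ≤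
    (1 - r ^ 2) ^ (-(d : ℝ) / 2) * Real.exp ((∑ j, y j ^ 2) / 2) := by
  have hpos : 0 < 1 - r ^ 2 := by nlinarith
  set F : (Fin d → ℕ) → ℝ := fun n =>
    ∏ j : Fin d, (r ^ (n j) * ((hermiteR (n j) (y j)) ^ 2 / (Nat.factorial (n j) : ℝ))) with hF
  have e1 : ∑ k ∈ Finset.range K, r ^ k * ∑ n ∈ Finset.Nat.antidiagonalTuple d k,
      ∏ j : Fin d, (hermiteR (n j) (y j)) ^ 2 / (Nat.factorial (n j) : ℝ) =
      ∑ k ∈ Finset.range K, ∑ n ∈ Finset.Nat.antidiagonalTuple d k, F n := by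
    refine Finset.sum_congr rfl fun k _ => ?_
    rw [Finset.mul_sum]
    refine Finset.sum_congr rfl fun n hn => ?_
    rw [hF]
    simp only [Finset.prod_mul_distrib]
    rw [Finset.prod_pow_eq_pow_sum, Finset.Nat.mem_antidiagonalTuple.1 hn]
  rw [e1, ← Finset.sum_biUnion]
  · calc _ ≤ ∑ n ∈ Fintype.piFinset (fun _ : Fin d => Finset.range K), F n := by
          refine Finset.sum_le_sum_of_subset_of_nonneg ?_ fun n _ _ =>
            Finset.prod_nonneg fun j _ => by positivity
          intro n hn
          simp only [Finset.mem_biUnion, Finset.mem_range, Finset.Nat.mem_antidiagonalTuple] at hn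
          obtain ⟨k, hk, hn⟩ := hn
          simp only [Fintype.mem_piFinset, Finset.mem_range]
          intro j
          have : n j ≤ ∑ i, n i := Finset.single_le_sum (fun i _ => Nat.zero_le _) (Finset.mem_univ j)
          omega
      _ = ∏ j : Fin d, ∑ n ∈ Finset.range K,
            (r ^ n * ((hermiteR n (y j)) ^ 2 / (Nat.factorial n : ℝ))) := by
          rw [Finset.prod_univ_sum]
      _ ≤ ∏ j : Fin d, ((1 - r ^ 2) ^ (-(1 : ℝ) / 2) * Real.exp (y j ^ 2 / 2)) := by
          refine Finset.prod_le_prod (fun j _ => Finset.sum_nonneg fun n _ => by positivity)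
            fun j _ => ?_
          exact trunc_bound (H := fun n => hermiteR n (y j)) (x := y j) (by simp [hermiteR])
            (by simp [hermiteR]) (fun n => herm_rec (y j) n) hr0 hr K
      _ = _ := by
          rw [Finset.prod_mul_distrib, Finset.prod_const, ← Real.exp_sum, Finset.sum_div,
            Finset.card_univ, Fintype.card_fin, ← Real.rpow_natCast, ← Real.rpow_mul hpos.le]
          congr 2
          ring
  · intro a _ b _ hab
    rw [Function.onFun, Finset.disjoint_left]
    intro n h1 h2
    rw [Finset.Nat.mem_antidiagonalTuple] at h1 h2
    exact hab (h1.symm.trans h2)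

lemma integrable_aux {a r : ℝ} (ha : 0 < a) (hr : 0 < r) :
    MeasureTheory.IntegrableOn (fun s : ℝ => s ^ (a - 1) * Real.exp (-(r * s))) (Set.Ioi 0) := by
  have := integrableOn_rpow_mul_exp_neg_mul_rpow (p := 1) (s := a - 1) (b := r)
    (by linarith) one_pos hr
  simpa using this

lemma kernel_aux (d : ℕ) (hd : 1 ≤ d) {s : ℝ} (hs : 0 < s) :
    Real.exp (-s) * (1 - Real.exp (-s) ^ 2) ^ (-(d : ℝ) / 2) ≤
      (d : ℝ) ^ ((d : ℝ) / 2) * (s ^ (-(d : ℝ) / 2) * Real.exp (-(1 / 2 * s))) := by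
  have hd1 : (1 : ℝ) ≤ d := by exact_mod_cast hd
  have hd0 : (0 : ℝ) < d := by linarith
  have h1 : Real.exp (-s) ^ 2 = Real.exp (-(2 * s)) := by
    rw [← Real.exp_nat_mul]; congr 1; push_cast; ring
  have hx : s / (d * Real.exp (s / d)) ≤ 1 - Real.exp (-s) ^ 2 := by
    rw [h1, Real.exp_neg]
    have h2 : 1 + 2 * s ≤ Real.exp (2 * s) := by linarith [Real.add_one_le_exp (2 * s)]
    have h3 : 1 + s / d ≤ Real.exp (s / d) := by linarith [Real.add_one_le_exp (s / d)]
    have h4 : (Real.exp (2 * s))⁻¹ ≤ (1 + 2 * s)⁻¹ := by gcongr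
    have h5 : d + s ≤ d * Real.exp (s / d) := by
      calc d + s = d * (1 + s / d) := by field_simp
        _ ≤ _ := by gcongr
    have h6 : s / (d * Real.exp (s / d)) ≤ s / (d + s) := by gcongr
    have h7 : s / (d + s) ≤ 1 - (1 + 2 * s)⁻¹ := by
      have : 1 - (1 + 2 * s)⁻¹ = 2 * s / (1 + 2 * s) := by field_simp; ring
      rw [this, div_le_div_iff₀ (by positivity) (by positivity)]
      nlinarith
    linarith
  have hpos : 0 < s / (d * Real.exp (s / d)) := by positivity
  have h8 := Real.rpow_le_rpow_of_nonpos hpos hx (by linarith : -(d : ℝ) / 2 ≤ 0)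
  have h9 : (s / (d * Real.exp (s / d))) ^ (-(d : ℝ) / 2) =
      (d : ℝ) ^ ((d : ℝ) / 2) * (s ^ (-(d : ℝ) / 2) * Real.exp (s / 2)) := by
    rw [Real.div_rpow hs.le (by positivity), Real.mul_rpow hd0.le (Real.exp_pos _).le,
      ← Real.exp_mul, neg_div, Real.rpow_neg hd0.le]
    have : s / d * -((d : ℝ) / 2) = -(s / 2) := by field_simp
    rw [this, Real.exp_neg]
    field_simp
  have h10 : Real.exp (-(1 / 2 * s)) = Real.exp (-s) * Real.exp (s / 2) := by
    rw [← Real.exp_add]; congr 1; ring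
  rw [h10]
  calc _ ≤ Real.exp (-s) * (s / (d * Real.exp (s / d))) ^ (-(d : ℝ) / 2) := by gcongr
    _ = _ := by rw [h9]; ring

lemma laplace_bound (d : ℕ) (hd : 1 ≤ d) (α : ℝ) (hα : (d : ℝ) / 2 < α) (a : ℕ → ℝ) (E : ℝ)
    (hE : 0 ≤ E) (K : ℕ)
    (h : ∀ r : ℝ, 0 ≤ r → r < 1 →
      ∑ k ∈ Finset.range K, r ^ k * a k ≤ (1 - r ^ 2) ^ (-(d : ℝ) / 2) * E) :
    Real.Gamma α * ∑ k ∈ Finset.range K, ((k : ℝ) + 1) ^ (-α) * a k ≤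
      (d : ℝ) ^ ((d : ℝ) / 2) * ((1 / (1 / 2)) ^ (α - d / 2) * Real.Gamma (α - d / 2)) * E := by
  have hd0 : (0 : ℝ) ≤ d := by positivity
  have hα0 : 0 < α := by linarith
  have e1 : Real.Gamma α * ∑ k ∈ Finset.range K, ((k : ℝ) + 1) ^ (-α) * a k =
      ∫ s in Set.Ioi (0 : ℝ), ∑ k ∈ Finset.range K,
        (s ^ (α - 1) * Real.exp (-(((k : ℝ) + 1) * s))) * a k := by
    rw [MeasureTheory.integral_finsetSum]
    · rw [Finset.mul_sum]
      refine Finset.sum_congr rfl fun k _ => ?_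
      rw [MeasureTheory.integral_mul_const,
        Real.integral_rpow_mul_exp_neg_mul_Ioi hα0 (by positivity), one_div,
        Real.inv_rpow (by positivity), Real.rpow_neg (by positivity)]
      ring
    · intro k _
      exact (integrable_aux hα0 (by positivity)).mul_const _
  have hβ : 0 < α - d / 2 := by linarith
  rw [e1, ← Real.integral_rpow_mul_exp_neg_mul_Ioi hβ (by norm_num : (0 : ℝ) < 1 / 2),
    ← MeasureTheory.integral_const_mul, ← MeasureTheory.integral_mul_const]
  refine MeasureTheory.setIntegral_mono_on ?_ ?_ measurableSet_Ioi ?_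
  · exact MeasureTheory.integrable_finsetSum _ fun k _ =>
      (integrable_aux hα0 (by positivity)).mul_const _
  · exact ((integrable_aux hβ (by norm_num)).const_mul _).mul_const _
  · intro s hs
    have hs : 0 < s := hs
    have hr := h (Real.exp (-s)) (Real.exp_pos _).le (by rw [Real.exp_lt_one_iff]; linarith)
    have e2 : ∑ k ∈ Finset.range K, (s ^ (α - 1) * Real.exp (-(((k : ℝ) + 1) * s))) * a k =
        s ^ (α - 1) * (Real.exp (-s) * ∑ k ∈ Finset.range K, Real.exp (-s) ^ k * a k) := by
      rw [Finset.mul_sum, Finset.mul_sum]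
      refine Finset.sum_congr rfl fun k _ => ?_
      have : Real.exp (-(((k : ℝ) + 1) * s)) = Real.exp (-s) * Real.exp (-s) ^ k := by
        rw [← Real.exp_nat_mul, ← Real.exp_add]; congr 1; ring
      rw [this]; ring
    rw [e2]
    have e3 : s ^ (α - d / 2 - 1) = s ^ (α - 1) * s ^ (-(d : ℝ) / 2) := by
      rw [← Real.rpow_add hs]; congr 1; ring
    calc _ ≤ s ^ (α - 1) * (Real.exp (-s) * ((1 - Real.exp (-s) ^ 2) ^ (-(d : ℝ) / 2) * E)) := by
          gcongr
      _ = s ^ (α - 1) * (Real.exp (-s) * (1 - Real.exp (-s) ^ 2) ^ (-(d : ℝ) / 2)) * E := by ring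
      _ ≤ s ^ (α - 1) * ((d : ℝ) ^ ((d : ℝ) / 2) *
            (s ^ (-(d : ℝ) / 2) * Real.exp (-(1 / 2 * s)))) * E := by
          exact mul_le_mul_of_nonneg_right (mul_le_mul_of_nonneg_left (kernel_aux d hd hs)
            (by positivity)) hE
      _ = _ := by rw [e3]; ring

/-- Let `d ≥ 1` and `γ < -d/2`.  There are constants `C > 0` and `c ∈ (0,1)` such that
for every `t > 0` and `u ∈ ℝ^d`,
`(Σ_k (k+1)^γ Σ_{n₁+⋯+n_d=k} Π_j H_{n_j}(u_j/√t)²/n_j!) · (p_t^d(u))² ≤ (C p_t^d(cu))²`. -/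
theorem stmt1 (d : ℕ) (hd : 1 ≤ d) (γ : ℝ) (hγ : γ < -(d : ℝ) / 2) :
    ∃ C > (0 : ℝ), ∃ c ∈ Set.Ioo (0 : ℝ) 1,
      ∀ t > (0 : ℝ), ∀ u : EuclideanSpace ℝ (Fin d),
        (∑' k : ℕ, ((k : ℝ) + 1) ^ γ *
            ∑ n ∈ Finset.Nat.antidiagonalTuple d k,
              ∏ j : Fin d, (hermiteR (n j) (u j / Real.sqrt t)) ^ 2 / (Nat.factorial (n j) : ℝ)) *
          (heatKernel d t u) ^ 2
        ≤ (C * heatKernel d t (c • u)) ^ 2 := by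
  
  have hd0 : (0 : ℝ) < d := by exact_mod_cast hd
  have hβ : 0 < -γ - d / 2 := by linarith
  have hα : 0 < -γ := by linarith
  have hΓ := Real.Gamma_pos_of_pos hα
  have hGb := Real.Gamma_pos_of_pos hβ
  set M : ℝ := (d : ℝ) ^ ((d : ℝ) / 2) *
    ((1 / (1 / 2)) ^ (-γ - d / 2) * Real.Gamma (-γ - d / 2)) / Real.Gamma (-γ) with hM
  have hM0 : 0 < M := by positivity
  refine ⟨Real.sqrt M, Real.sqrt_pos.2 hM0, 1 / 2, ⟨by norm_num, by norm_num⟩, ?_⟩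
  intro t ht u
  set y : Fin d → ℝ := fun j => u j / Real.sqrt t with hy
  have hyn : ∑ j, y j ^ 2 = ‖u‖ ^ 2 / t := by
    rw [EuclideanSpace.norm_sq_eq, Finset.sum_div]
    refine Finset.sum_congr rfl fun j _ => ?_
    rw [hy]
    simp only [div_pow, Real.sq_sqrt ht.le, Real.norm_eq_abs, sq_abs]
  have hS : (∑' k : ℕ, ((k : ℝ) + 1) ^ γ *
      ∑ n ∈ Finset.Nat.antidiagonalTuple d k,
        ∏ j : Fin d, (hermiteR (n j) (u j / Real.sqrt t)) ^ 2 / (Nat.factorial (n j) : ℝ)) ≤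
      M * Real.exp (‖u‖ ^ 2 / t / 2) := by
    refine Real.tsum_le_of_sum_range_le (fun k => mul_nonneg (by positivity)
      (Finset.sum_nonneg fun n _ => Finset.prod_nonneg fun j _ => by positivity)) fun K => ?_
    have := laplace_bound d hd (-γ) (by linarith) (fun k =>
      ∑ n ∈ Finset.Nat.antidiagonalTuple d k,
        ∏ j : Fin d, (hermiteR (n j) (y j)) ^ 2 / (Nat.factorial (n j) : ℝ))
      (Real.exp ((∑ j, y j ^ 2) / 2)) (Real.exp_pos _).le K
      (fun r hr0 hr => multi_bound d y hr0 hr K)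
    rw [hyn, neg_neg, mul_comm (Real.Gamma (-γ)), ← le_div_iff₀ hΓ] at this
    refine this.trans (le_of_eq ?_)
    rw [hM]; ring
  refine (mul_le_mul_of_nonneg_right hS (sq_nonneg _)).trans ?_
  unfold heatKernel
  rw [mul_pow (Real.sqrt M), Real.sq_sqrt hM0.le, mul_assoc]
  gcongr M * ?_
  rw [mul_pow, mul_pow, mul_left_comm]
  gcongr
  rw [← Real.exp_nat_mul, ← Real.exp_nat_mul, ← Real.exp_add]
  apply Real.exp_le_exp.2
  rw [norm_smul, mul_pow, Real.norm_eq_abs]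
  norm_num
  have h0 : 0 ≤ ‖u‖ ^ 2 / t := by positivity
  have e1 : 2 * (-‖u‖ ^ 2 / (2 * t)) = -(‖u‖ ^ 2 / t) := by field_simp
  have e2 : 2 * (-(1 / 4 * ‖u‖ ^ 2) / (2 * t)) = -(1 / 4 * (‖u‖ ^ 2 / t)) := by field_simp
  rw [e1, e2]
  linarith
end

section
/- Let γ₁ ≤ 0 and γ₂ ≤ 0 be real numbers and let a, b : ℕ → [0,∞] be sequences of extended nonnegative reals. Then Σ_{k=0}^∞ (k+1)^{γ₁+γ₂} ( Σ_{i=0}^k a_i · b_{k-i} ) ≤ ( Σ_{i=0}^∞ (i+1)^{γ₁} a_i ) · ( Σ_{j=0}^∞ (j+1)^{γ₂} b_j ). -/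
open scoped ENNReal BigOperators

lemma rpow_anti_aux {x y : ℝ≥0∞} {z : ℝ} (hz : z ≤ 0) (h : x ≤ y) : y ^ z ≤ x ^ z := by
  have := ENNReal.rpow_le_rpow h (neg_nonneg.mpr hz)
  rw [ENNReal.rpow_neg, ENNReal.rpow_neg] at this
  exact ENNReal.inv_le_inv.mp this

/-- For `γ₁, γ₂ ≤ 0` and sequences `a b : ℕ → [0,∞]`,
`Σ_k (k+1)^{γ₁+γ₂} (Σ_{i+j=k} a_i b_j) ≤ (Σ_i (i+1)^{γ₁} a_i)(Σ_j (j+1)^{γ₂} b_j)`. -/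
theorem stmt2 (γ₁ γ₂ : ℝ) (h1 : γ₁ ≤ 0) (h2 : γ₂ ≤ 0) (a b : ℕ → ℝ≥0∞) :
    ∑' k : ℕ, ((k : ℝ≥0∞) + 1) ^ (γ₁ + γ₂) * ∑ i ∈ Finset.range (k + 1), a i * b (k - i)
      ≤ (∑' i : ℕ, ((i : ℝ≥0∞) + 1) ^ γ₁ * a i) * (∑' j : ℕ, ((j : ℝ≥0∞) + 1) ^ γ₂ * b j) := by
  set f : ℕ → ℝ≥0∞ := fun i => ((i : ℝ≥0∞) + 1) ^ γ₁ * a i with hf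
  set g : ℕ → ℝ≥0∞ := fun j => ((j : ℝ≥0∞) + 1) ^ γ₂ * b j with hg
  have key : (∑' i, f i) * (∑' j, g j)
      = ∑' k : ℕ, ∑ p ∈ Finset.HasAntidiagonal.antidiagonal k, f p.1 * g p.2 := by
    have e : (∑' i, f i) * (∑' j, g j) = ∑' p : ℕ × ℕ, f p.1 * g p.2 := by
      rw [ENNReal.tsum_prod (f := fun i j => f i * g j), ← ENNReal.tsum_mul_right]
      simp_rw [ENNReal.tsum_mul_left]
    rw [e, ← Finset.HasAntidiagonal.sigmaAntidiagonalEquivProd.tsum_eq, ENNReal.tsum_sigma']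
    refine tsum_congr fun k => ?_
    rw [tsum_fintype]
    exact Finset.sum_coe_sort (Finset.HasAntidiagonal.antidiagonal k) (fun p => f p.1 * g p.2)
  rw [key]
  refine ENNReal.tsum_le_tsum fun k => ?_
  rw [Finset.Nat.sum_antidiagonal_eq_sum_range_succ (fun i j => f i * g j), Finset.mul_sum]
  refine Finset.sum_le_sum fun i hi => ?_
  have hik : i ≤ k := Nat.lt_succ_iff.mp (Finset.mem_range.mp hi)
  have hA : ((k : ℝ≥0∞) + 1) ^ γ₁ ≤ ((i : ℝ≥0∞) + 1) ^ γ₁ :=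
    rpow_anti_aux h1 (by gcongr)
  have hB : ((k : ℝ≥0∞) + 1) ^ γ₂ ≤ (((k - i : ℕ) : ℝ≥0∞) + 1) ^ γ₂ :=
    rpow_anti_aux h2 (by gcongr; exact Nat.sub_le k i)
  rw [ENNReal.rpow_add _ _ (by simp) (by simp)]
  calc _ ≤ ((i : ℝ≥0∞) + 1) ^ γ₁ * (((k - i : ℕ) : ℝ≥0∞) + 1) ^ γ₂ * (a i * b (k - i)) := by
        gcongr
    _ = f i * g (k - i) := by simp only [hf, hg]; ring
end

section
/- Let d ≥ 1 and k ≥ 2 be integers, let c > 0, and let u_1, …, u_{k-1} ∈ ℝ^d all be nonzero. Then the integral ∫_{Δ_k} Π_{j=1}^{k-1} p^d_{t_{j+1}-t_j}(c·u_j) dt_1⋯dt_k is finite, where Δ_k = { (t_1,…,t_k) ∈ [0,1]^k : t_1 < t_2 < ⋯ < t_k }. -/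
open MeasureTheory
open scoped BigOperators

lemma heatKernel_le_aux (d : ℕ) (z : EuclideanSpace ℝ (Fin d)) (hz : z ≠ 0) (t : ℝ)
    (ht : 0 < t) (ht1 : t ≤ 1) :
    heatKernel d t z ≤ (d.factorial : ℝ) / (‖z‖ ^ 2 / 2) ^ d := by
  have ha : 0 < ‖z‖ ^ 2 / 2 := by
    have := norm_pos_iff.2 hz
    positivity
  unfold heatKernel
  have he : -‖z‖ ^ 2 / (2 * t) = -((‖z‖ ^ 2 / 2) / t) := by
    field_simp
  rw [he]
  generalize ‖z‖ ^ 2 / 2 = a at *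
  have h1 : (2 * Real.pi * t) ^ (-(d : ℝ) / 2) ≤ (t ^ d)⁻¹ := by
    have hd0 : (0 : ℝ) ≤ d := Nat.cast_nonneg d
    have e1 : (2 * Real.pi * t) ^ (-(d : ℝ) / 2) ≤ t ^ (-(d : ℝ) / 2) := by
      apply Real.rpow_le_rpow_of_nonpos ht
      · nlinarith [Real.pi_gt_three]
      · linarith
    have e2 : t ^ (-(d : ℝ) / 2) ≤ t ^ (-(d : ℝ)) :=
      Real.rpow_le_rpow_of_exponent_ge ht ht1 (by linarith)
    rw [Real.rpow_neg ht.le, Real.rpow_natCast] at e2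
    exact e1.trans e2
  have h2 : Real.exp (-(a / t)) ≤ d.factorial * t ^ d / a ^ d := by
    have h := Real.pow_div_factorial_le_exp (a / t) (by positivity) d
    rw [Real.exp_neg]
    have hp : 0 < (a / t) ^ d / (d.factorial : ℝ) := by positivity
    calc (Real.exp (a / t))⁻¹ ≤ ((a / t) ^ d / (d.factorial : ℝ))⁻¹ := by gcongr
      _ = _ := by rw [div_pow]; field_simp
  calc _ ≤ (t ^ d)⁻¹ * (d.factorial * t ^ d / a ^ d) := by gcongr
    _ = _ := by field_simp

/-- Let `d ≥ 1`, `k = m + 1 ≥ 2`, `c > 0`, and `u_1, …, u_{k-1} ∈ ℝ^d` nonzero.  Then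
`∫_{Δ_k} Π_{j=1}^{k-1} p^d_{t_{j+1}-t_j}(c u_j) dt < ∞`, where
`Δ_k = { t ∈ [0,1]^k : t_1 < ⋯ < t_k }`. -/
theorem stmt4 (d m : ℕ) (hd : 1 ≤ d) (hm : 1 ≤ m) (c : ℝ) (hc : 0 < c)
    (u : Fin m → EuclideanSpace ℝ (Fin d)) (hu : ∀ j, u j ≠ 0) :
    ∫⁻ t in {t : Fin (m + 1) → ℝ | (∀ i, t i ∈ Set.Icc (0 : ℝ) 1) ∧ StrictMono t},
      ENNReal.ofReal (∏ j : Fin m, heatKernel d (t j.succ - t j.castSucc) (c • u j)) < ⊤ := by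
  set S := {t : Fin (m + 1) → ℝ | (∀ i, t i ∈ Set.Icc (0 : ℝ) 1) ∧ StrictMono t} with hS
  have hfin : volume S < ⊤ := by
    refine lt_of_le_of_lt (measure_mono (t := Set.Icc 0 1) ?_) isCompact_Icc.measure_lt_top
    intro t ht
    exact ⟨fun i => (ht.1 i).1, fun i => (ht.1 i).2⟩
  have hmeas : MeasurableSet S := by
    have : S = (⋂ i, {t : Fin (m + 1) → ℝ | t i ∈ Set.Icc (0 : ℝ) 1}) ∩
        ⋂ i, ⋂ j, ⋂ (_ : i < j), {t : Fin (m + 1) → ℝ | t i < t j} := by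
      ext t
      simp [hS, StrictMono]
    rw [this]
    refine MeasurableSet.inter (MeasurableSet.iInter fun i => ?_)
      (MeasurableSet.iInter fun i => MeasurableSet.iInter fun j => MeasurableSet.iInter fun _ => ?_)
    · exact measurable_pi_apply i measurableSet_Icc
    · exact measurableSet_lt (measurable_pi_apply i) (measurable_pi_apply j)
  refine lt_of_le_of_lt (setLIntegral_mono' (g := fun _ => ENNReal.ofReal
    (∏ j : Fin m, (d.factorial : ℝ) / (‖c • u j‖ ^ 2 / 2) ^ d)) hmeas ?_) ?_
  · intro t ht
    apply ENNReal.ofReal_le_ofReal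
    have hpos : ∀ j : Fin m, 0 < t j.succ - t j.castSucc := fun j =>
      sub_pos.2 (ht.2 Fin.castSucc_lt_succ)
    apply Finset.prod_le_prod
    · intro j _
      have := hpos j
      unfold heatKernel
      positivity
    · intro j _
      refine heatKernel_le_aux d _ (smul_ne_zero hc.ne' (hu j)) _ (hpos j) ?_
      have h1 := (ht.1 j.succ).2
      have h2 := (ht.1 j.castSucc).1
      linarith
  · rw [setLIntegral_const]
    exact ENNReal.mul_lt_top ENNReal.ofReal_lt_top hfin
end

section
/- Let (Ω, 𝓕, P) be a probability space, let d ≥ 1 be an integer and t > 0. Let Y : Ω → ℝ^d be a random vector whose law has density z ↦ p_t^d(z) with respect to Lebesgue measure on ℝ^d, let X : Ω → ℝ be a random variable independent of Y, let h : ℝ^d × ℝ → ℝ be bounded and continuous, and let u ∈ ℝ^d. Then lim_{ε → 0⁺} E[ h(Y, X) · p_ε^d(Y - u) ] = p_t^d(u) · E[ h(u, X) ]. -/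
open MeasureTheory

theorem heatKernel_continuous (d : ℕ) (t : ℝ) : Continuous (heatKernel d t) := by
  unfold heatKernel
  fun_prop

theorem heatKernel_nonneg (d : ℕ) (t : ℝ) (ht : 0 < t) (z : EuclideanSpace ℝ (Fin d)) :
    0 ≤ heatKernel d t z := by
  unfold heatKernel
  positivity

theorem heatKernel_integral (d : ℕ) (t : ℝ) (ht : 0 < t) :
    ∫ z, heatKernel d t z = 1 := by
  have hb : 0 < 1 / (2 * t) := by positivity
  have h1 := GaussianFourier.integral_rexp_neg_mul_sq_norm
    (V := EuclideanSpace ℝ (Fin d)) hb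
  unfold heatKernel
  rw [integral_const_mul]
  have h2 : (fun z : EuclideanSpace ℝ (Fin d) => Real.exp (-‖z‖ ^ 2 / (2 * t)))
      = fun z => Real.exp (-(1 / (2 * t)) * ‖z‖ ^ 2) := by
    funext z
    congr 1
    ring
  rw [h2, h1, finrank_euclideanSpace_fin]
  have h3 : Real.pi / (1 / (2 * t)) = 2 * Real.pi * t := by
    field_simp
  have h4 : 0 < 2 * Real.pi * t := by positivity
  rw [h3, ← Real.rpow_add h4, neg_div, neg_add_cancel, Real.rpow_zero]

theorem heatKernel_decay (d : ℕ) :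
    Filter.Tendsto (fun x : EuclideanSpace ℝ (Fin d) => ‖x‖ ^ d * heatKernel d 1 x)
      (Bornology.cobounded _) (nhds 0) := by
  have h1 := (Real.tendsto_pow_mul_exp_neg_atTop_nhds_zero d).comp
    (tendsto_norm_cobounded_atTop (E := EuclideanSpace ℝ (Fin d)))
  have h2 := h1.const_mul ((2 * Real.pi * 1) ^ (-(d : ℝ) / 2) * Real.exp (1 / 2))
  rw [mul_zero] at h2
  refine squeeze_zero (fun x => mul_nonneg (by positivity)
    (heatKernel_nonneg d 1 one_pos x)) (fun x => ?_) h2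
  have h3 : Real.exp (-‖x‖ ^ 2 / (2 * 1)) ≤ Real.exp (1 / 2) * Real.exp (-‖x‖) := by
    rw [← Real.exp_add]
    apply Real.exp_le_exp.2
    nlinarith [sq_nonneg (‖x‖ - 1)]
  have h4 : 0 ≤ ‖x‖ ^ d * (2 * Real.pi * 1) ^ (-(d : ℝ) / 2) := by positivity
  have h5 := mul_le_mul_of_nonneg_left h3 h4
  simp only [heatKernel, Function.comp]
  linarith

theorem heatKernel_scale (d : ℕ) (ε : ℝ) (hε : 0 < ε) (y u : EuclideanSpace ℝ (Fin d)) :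
    heatKernel d ε (y - u)
      = ((√ε)⁻¹) ^ d * heatKernel d 1 ((√ε)⁻¹ • (u - y)) := by
  unfold heatKernel
  have hs : 0 < √ε := Real.sqrt_pos.2 hε
  have h1 : ((√ε)⁻¹) ^ d = ε ^ (-(d : ℝ) / 2) := by
    rw [Real.sqrt_eq_rpow, ← Real.rpow_neg hε.le, ← Real.rpow_natCast, ← Real.rpow_mul hε.le]
    congr 1
    ring
  rw [h1, mul_one, Real.mul_rpow (by positivity) hε.le, norm_smul, norm_sub_rev u y, mul_pow,
    Real.norm_eq_abs, sq_abs, inv_pow, Real.sq_sqrt hε.le]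
  have h2 : -‖y - u‖ ^ 2 / (2 * ε) = -(ε⁻¹ * ‖y - u‖ ^ 2) / (2 * 1) := by
    field_simp
  rw [h2]
  ring

/-- Let `Y` be a random vector in `ℝ^d` with density `p_t^d`, let `X` be a real random
variable independent of `Y`, let `h` be bounded continuous, `u ∈ ℝ^d`.  Then
`lim_{ε → 0⁺} E[h(Y,X) p_ε^d(Y-u)] = p_t^d(u) E[h(u,X)]`. -/
theorem stmt7 (Ω : Type*) [MeasurableSpace Ω] (P : Measure Ω) [IsProbabilityMeasure P]
    (d : ℕ) (hd : 1 ≤ d) (t : ℝ) (ht : 0 < t)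
    (Y : Ω → EuclideanSpace ℝ (Fin d)) (hY : Measurable Y)
    (hlaw : Measure.map Y P
      = volume.withDensity fun z => ENNReal.ofReal (heatKernel d t z))
    (X : Ω → ℝ) (hX : Measurable X)
    (hindep : ProbabilityTheory.IndepFun X Y P)
    (h : EuclideanSpace ℝ (Fin d) × ℝ → ℝ) (hcont : Continuous h)
    (hbdd : ∃ M : ℝ, ∀ z, |h z| ≤ M)
    (u : EuclideanSpace ℝ (Fin d)) :
    Filter.Tendsto (fun ε : ℝ => ∫ ω, h (Y ω, X ω) * heatKernel d ε (Y ω - u) ∂P)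
      (nhdsWithin 0 (Set.Ioi 0))
      (nhds (heatKernel d t u * ∫ ω, h (u, X ω) ∂P)) := by
  obtain ⟨M, hM⟩ := hbdd
  have hcK := heatKernel_continuous d
  set G : EuclideanSpace ℝ (Fin d) → ℝ := fun y => ∫ ω, h (y, X ω) ∂P with hG
  have hGc : Continuous G := by
    refine continuous_of_dominated (bound := fun _ => M) ?_ ?_ (integrable_const M) ?_
    · intro y
      exact (hcont.measurable.comp (by fun_prop)).aestronglyMeasurable
    · intro y
      exact Filter.Eventually.of_forall fun ω => hM _
    · exact Filter.Eventually.of_forall fun ω => by fun_prop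
  have hGb : ∀ y, ‖G y‖ ≤ M := by
    intro y
    have := norm_integral_le_of_norm_le_const (μ := P) (f := fun ω => h (y, X ω)) (C := M)
      (Filter.Eventually.of_forall fun ω => hM _)
    simpa using this
  have hKi : Integrable (heatKernel d t) :=
    integrable_of_integral_eq_one (heatKernel_integral d t ht)
  have hgi : Integrable (fun y => heatKernel d t y * G y) :=
    hKi.mul_bdd hGc.aestronglyMeasurable (Filter.Eventually.of_forall hGb)
  have main := tendsto_integral_comp_smul_smul_of_integrable' (μ := volume)
    (heatKernel_nonneg d 1 one_pos) (heatKernel_integral d 1 one_pos)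
    (by simpa using heatKernel_decay d) hgi
    (x₀ := u) ((hcK t).mul hGc).continuousAt
  have hc : Filter.Tendsto (fun ε : ℝ => (√ε)⁻¹) (nhdsWithin 0 (Set.Ioi 0)) Filter.atTop := by
    refine tendsto_inv_nhdsGT_zero.comp ?_
    refine tendsto_nhdsWithin_iff.2 ⟨?_, ?_⟩
    · have := Real.continuous_sqrt.tendsto 0
      rw [Real.sqrt_zero] at this
      exact this.mono_left nhdsWithin_le_nhds
    · filter_upwards [self_mem_nhdsWithin] with ε hε
      exact Real.sqrt_pos.2 hε
  refine (main.comp hc).congr' ?_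
  filter_upwards [self_mem_nhdsWithin] with ε hε
  have hε' : 0 < ε := hε
  simp only [Function.comp, finrank_euclideanSpace_fin, ← heatKernel_scale d ε hε', smul_eq_mul]
  have hprod : P.map (fun ω => (Y ω, X ω)) = (P.map Y).prod (P.map X) :=
    (ProbabilityTheory.indepFun_iff_map_prod_eq_prod_map_map hY.aemeasurable
      hX.aemeasurable).1 hindep.symm
  have : IsProbabilityMeasure (P.map Y) := Measure.isProbabilityMeasure_map hY.aemeasurable
  have : IsProbabilityMeasure (P.map X) := Measure.isProbabilityMeasure_map hX.aemeasurable
  have hFc : Continuous fun z : EuclideanSpace ℝ (Fin d) × ℝ =>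
      h z * heatKernel d ε (z.1 - u) :=
    hcont.mul ((hcK ε).comp (by fun_prop))
  have hKb : ∀ z, ‖heatKernel d ε z‖ ≤ (2 * Real.pi * ε) ^ (-(d : ℝ) / 2) := by
    intro z
    rw [Real.norm_of_nonneg (heatKernel_nonneg d ε hε' z)]
    unfold heatKernel
    refine mul_le_of_le_one_right (by positivity) (Real.exp_le_one_iff.2 ?_)
    rw [neg_div]
    have : 0 ≤ ‖z‖ ^ 2 / (2 * ε) := by positivity
    linarith
  have hFi : Integrable (fun z : EuclideanSpace ℝ (Fin d) × ℝ =>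
      h z * heatKernel d ε (z.1 - u)) ((P.map Y).prod (P.map X)) := by
    refine Integrable.of_bound hFc.aestronglyMeasurable
      (M * (2 * Real.pi * ε) ^ (-(d : ℝ) / 2)) (Filter.Eventually.of_forall fun z => ?_)
    rw [norm_mul]
    exact mul_le_mul (hM z) (hKb _) (norm_nonneg _) ((abs_nonneg _).trans (hM z))
  have e1 : ∫ ω, h (Y ω, X ω) * heatKernel d ε (Y ω - u) ∂P
      = ∫ z, h z * heatKernel d ε (z.1 - u) ∂(P.map fun ω => (Y ω, X ω)) :=
    (integral_map (hY.prodMk hX).aemeasurable hFc.aestronglyMeasurable).symm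
  have e2 : ∀ y, ∫ x, h (y, x) * heatKernel d ε (y - u) ∂(P.map X)
      = G y * heatKernel d ε (y - u) := by
    intro y
    rw [integral_mul_const, integral_map hX.aemeasurable]
    exact (hcont.comp (by fun_prop)).aestronglyMeasurable
  rw [e1, hprod, integral_prod _ hFi]
  simp only [e2]
  rw [hlaw, integral_withDensity_eq_integral_toReal_smul
    (hcK t).measurable.ennreal_ofReal (Filter.Eventually.of_forall fun _ => ENNReal.ofReal_lt_top)]
  refine integral_congr_ae (Filter.Eventually.of_forall fun y => ?_)
  simp only [ENNReal.toReal_ofReal (heatKernel_nonneg d t ht y), smul_eq_mul]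
  ring
end

section
/- Let d ≥ 4 be an integer and let f : ℝ → [0,∞) be measurable with ∫_ℝ f(x)² e^{-x²/2} dx < ∞. Then, as u → 0 in ℝ^d \ {0}, ∫_{Δ_2} p^d_{t_2-t_1}(u) · ( ∫_ℝ f(x) p^1_{t_2-t_1}(x) dx ) dt_1 dt_2 = O( ‖u‖^{-(d - 3/2)} ); that is, there exist constants C > 0 and δ > 0 such that for all u ∈ ℝ^d with 0 < ‖u‖ < δ, the double integral is at most C ‖u‖^{3/2 - d}. -/
open MeasureTheory

/-- The one-dimensional Gaussian heat kernel `p_t^1(x) = (2πt)^{-1/2} exp(-x²/(2t))`. -/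
noncomputable def heatKernel1 (t x : ℝ) : ℝ :=
  (2 * Real.pi * t) ^ (-(1 : ℝ) / 2) * Real.exp (-x ^ 2 / (2 * t))

theorem aux_inner (f : ℝ → ℝ) (hf : Measurable f) (hf0 : ∀ x, 0 ≤ f x) (s : ℝ) (hs : 0 < s)
    (hs1 : s ≤ 1) (A : ℝ) (hA0 : 0 ≤ A)
    (hA : ∫⁻ x, ENNReal.ofReal (f x ^ 2 * Real.exp (-x ^ 2 / 2)) = ENNReal.ofReal A) :
    ∫⁻ x, ENNReal.ofReal (f x * heatKernel1 s x)
      ≤ ENNReal.ofReal ((A + 1) * (2 * Real.pi * s) ^ (-(1 / 4) : ℝ)) := by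
  have hq : 0 < 2 * Real.pi * s := by positivity
  obtain ⟨q, hqd⟩ : ∃ q, q = 2 * Real.pi * s := ⟨_, rfl⟩
  rw [← hqd] at hq
  set a : ℝ := q ^ (-(1 / 4) : ℝ) with ha
  have ha0 : 0 < a := Real.rpow_pos_of_pos hq _
  have h1 : q ^ (-(1 : ℝ) / 2) = a ^ 2 := by
    rw [ha, ← Real.rpow_natCast, ← Real.rpow_mul hq.le]; norm_num
  have h2 : √q = (a ^ 2)⁻¹ := by
    rw [← h1, ← Real.rpow_neg hq.le, Real.sqrt_eq_rpow]; norm_num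
  have key : ∀ x, f x * heatKernel1 s x
      ≤ a * (f x ^ 2 * Real.exp (-x ^ 2 / 2)) + a ^ 3 * Real.exp (-(1 / (2 * s)) * x ^ 2) := by
    intro x
    unfold heatKernel1
    rw [← hqd, h1]
    set w := Real.exp (-x ^ 2 / 4) with hw
    have hw0 : 0 < w := Real.exp_pos _
    have hw2 : Real.exp (-x ^ 2 / 2) = w ^ 2 := by
      rw [hw, ← Real.exp_nat_mul]; congr 1; push_cast; ring
    set v := Real.exp (-x ^ 2 / (2 * s) + x ^ 2 / 4) with hv
    have hv0 : 0 < v := Real.exp_pos _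
    have hwv : Real.exp (-x ^ 2 / (2 * s)) = w * v := by
      rw [hw, hv, ← Real.exp_add]; congr 1; ring
    have hv2 : v ^ 2 ≤ Real.exp (-(1 / (2 * s)) * x ^ 2) := by
      rw [hv, ← Real.exp_nat_mul]
      apply Real.exp_le_exp.2
      have h3 : 1 ≤ 1 / s := by rw [le_div_iff₀ hs]; linarith
      have h4 : 0 ≤ x ^ 2 * (1 / s - 1) := by
        apply mul_nonneg (sq_nonneg _); linarith
      have h5 : (-(1 / (2 * s)) * x ^ 2) - ((2 : ℕ) : ℝ) * (-x ^ 2 / (2 * s) + x ^ 2 / 4)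
          = x ^ 2 * (1 / s - 1) / 2 := by
        push_cast; field_simp; ring
      linarith
    rw [hw2, hwv]
    have h6 : a ^ 3 * v ^ 2 ≤ a ^ 3 * Real.exp (-(1 / (2 * s)) * x ^ 2) := by gcongr
    have h7 : 0 ≤ a * (f x * w - a * v) ^ 2 := by positivity
    have h8 : 0 ≤ f x * (a ^ 2 * (w * v)) := by have := hf0 x; positivity
    nlinarith
  have hg : ∫⁻ x, ENNReal.ofReal (Real.exp (-(1 / (2 * s)) * x ^ 2)) = ENNReal.ofReal (√q) := by
    rw [← ofReal_integral_eq_lintegral_ofReal (integrable_exp_neg_mul_sq (by positivity))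
      (Filter.Eventually.of_forall fun x => (Real.exp_pos _).le), integral_gaussian, hqd]
    congr 2
    field_simp
  calc ∫⁻ x, ENNReal.ofReal (f x * heatKernel1 s x)
      ≤ ∫⁻ x, (ENNReal.ofReal a * ENNReal.ofReal (f x ^ 2 * Real.exp (-x ^ 2 / 2))
          + ENNReal.ofReal (a ^ 3) * ENNReal.ofReal (Real.exp (-(1 / (2 * s)) * x ^ 2))) := by
        apply lintegral_mono
        intro x
        refine (ENNReal.ofReal_le_ofReal (key x)).trans ?_
        rw [ENNReal.ofReal_add (by positivity) (by positivity), ENNReal.ofReal_mul ha0.le,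
          ENNReal.ofReal_mul (p := a ^ 3) (by positivity)]
    _ = ENNReal.ofReal a * ENNReal.ofReal A + ENNReal.ofReal (a ^ 3) * ENNReal.ofReal (√q) := by
        rw [lintegral_add_left (by fun_prop), lintegral_const_mul _ (by fun_prop),
          lintegral_const_mul _ (by fun_prop), hA, hg]
    _ = ENNReal.ofReal ((A + 1) * (2 * Real.pi * s) ^ (-(1 / 4) : ℝ)) := by
        rw [← ENNReal.ofReal_mul ha0.le, ← ENNReal.ofReal_mul (by positivity),
          ← ENNReal.ofReal_add (by positivity) (by positivity), ← hqd, ← ha, h2]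
        congr 1
        field_simp

theorem aux_exp (d : ℕ) (α y : ℝ) (hα : α ≤ d) (hy : 1 ≤ y) :
    y ^ α * Real.exp (-y / 2) ≤ 2 ^ d * d.factorial := by
  have h1 : y ^ α ≤ y ^ d := by
    rw [← Real.rpow_natCast]; exact Real.rpow_le_rpow_of_exponent_le hy hα
  have h2 := Real.pow_div_factorial_le_exp (y / 2) (by linarith) d
  have h3 : y ^ d ≤ 2 ^ d * d.factorial * Real.exp (y / 2) := by
    rw [div_pow, div_div, div_le_iff₀ (by positivity)] at h2
    linarith
  have h4 : Real.exp (y / 2) * Real.exp (-y / 2) = 1 := by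
    rw [← Real.exp_add, ← Real.exp_zero]; congr 1; ring
  calc y ^ α * Real.exp (-y / 2) ≤ (2 ^ d * d.factorial * Real.exp (y / 2)) * Real.exp (-y / 2) := by
        gcongr; exact h1.trans h3
    _ = _ := by rw [mul_assoc, h4, mul_one]

noncomputable def auxH (M α r s : ℝ) : ENNReal :=
  (Set.Ioc 0 (r ^ 2)).indicator (fun _ => ENNReal.ofReal (M * r ^ (-(2 * α)))) s
    + (Set.Ioi (r ^ 2)).indicator (fun s => ENNReal.ofReal (s ^ (-α))) s

theorem auxH_meas (M α r : ℝ) : Measurable (auxH M α r) := by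
  unfold auxH
  refine Measurable.add ?_ ?_
  · exact measurable_const.indicator measurableSet_Ioc
  · exact Measurable.indicator (by fun_prop) measurableSet_Ioi

theorem auxH_int (M α r : ℝ) (hM : 0 ≤ M) (hα : 1 < α) (hr : 0 < r) :
    ∫⁻ s, auxH M α r s = ENNReal.ofReal ((M + 1 / (α - 1)) * r ^ (2 - 2 * α)) := by
  have hr2 : 0 < r ^ 2 := by positivity
  have hα' : 0 < α - 1 := by linarith
  have e1 : r ^ (-(2 * α)) * r ^ 2 = r ^ (2 - 2 * α) := by
    rw [← Real.rpow_natCast r 2, ← Real.rpow_add hr]; congr 1; push_cast; ring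
  have e2 : (r ^ 2) ^ (-α + 1) = r ^ (2 - 2 * α) := by
    rw [← Real.rpow_natCast r 2, ← Real.rpow_mul hr.le]; congr 1; push_cast; ring
  unfold auxH
  rw [lintegral_add_left (measurable_const.indicator measurableSet_Ioc),
    lintegral_indicator measurableSet_Ioc, lintegral_indicator measurableSet_Ioi,
    setLIntegral_const, Real.volume_Ioc,
    ← ofReal_integral_eq_lintegral_ofReal (integrableOn_Ioi_rpow_of_lt (by linarith) hr2)
      ((ae_restrict_iff' measurableSet_Ioi).2 (Filter.Eventually.of_forall fun x hx =>
        Real.rpow_nonneg (hr2.le.trans (le_of_lt hx)) _)),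
    integral_Ioi_rpow_of_lt (by linarith) hr2, ← ENNReal.ofReal_mul (by positivity), e2,
    ← ENNReal.ofReal_add]
  · congr 1
    rw [sub_zero, mul_assoc, e1, add_mul]
    congr 1
    rw [show -α + 1 = -(α - 1) by ring, neg_div_neg_eq]; ring
  · rw [sub_zero]; positivity
  · rw [show -α + 1 = -(α - 1) by ring, neg_div_neg_eq]; positivity

theorem aux_pt (d : ℕ) (α r s : ℝ) (hα0 : 0 < α) (hα : α ≤ d) (hr : 0 < r) (hs : 0 < s) :
    ENNReal.ofReal ((2 * Real.pi * s) ^ (-α) * Real.exp (-r ^ 2 / (2 * s)))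
      ≤ auxH (2 ^ d * d.factorial) α r s := by
  have h0 : (2 * Real.pi * s) ^ (-α) ≤ s ^ (-α) := by
    apply Real.rpow_le_rpow_of_nonpos hs _ (by linarith)
    have := Real.pi_gt_three
    nlinarith
  unfold auxH
  rcases le_or_gt s (r ^ 2) with h | h
  · refine le_add_right ?_
    rw [Set.indicator_of_mem (show s ∈ Set.Ioc 0 (r ^ 2) from ⟨hs, h⟩)]
    apply ENNReal.ofReal_le_ofReal
    have h1 := aux_exp d α (r ^ 2 / s) hα (by rw [le_div_iff₀ hs]; linarith)
    have h2 : s ^ (-α) = r ^ (-(2 * α)) * (r ^ 2 / s) ^ α := by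
      rw [Real.div_rpow (by positivity) hs.le, Real.rpow_neg hs.le, Real.rpow_neg hr.le,
        ← Real.rpow_natCast r 2, ← Real.rpow_mul hr.le]
      have : r ^ (2 * α) ≠ 0 := (Real.rpow_pos_of_pos hr _).ne'
      push_cast
      field_simp
    have h3 : -r ^ 2 / (2 * s) = -(r ^ 2 / s) / 2 := by field_simp
    calc _ ≤ s ^ (-α) * Real.exp (-r ^ 2 / (2 * s)) := by gcongr
      _ = r ^ (-(2 * α)) * ((r ^ 2 / s) ^ α * Real.exp (-(r ^ 2 / s) / 2)) := by
        rw [h2, h3, mul_assoc]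
      _ ≤ r ^ (-(2 * α)) * (2 ^ d * d.factorial) := by gcongr
      _ = _ := mul_comm _ _
  · refine le_add_left ?_
    rw [Set.indicator_of_mem (show s ∈ Set.Ioi (r ^ 2) from h)]
    apply ENNReal.ofReal_le_ofReal
    calc _ ≤ s ^ (-α) * 1 := by
          gcongr
          apply Real.exp_le_one_iff.2
          rw [neg_div]; exact neg_nonpos.2 (by positivity)
      _ = _ := mul_one _

theorem aux_outer (H : ℝ → ENNReal) (hH : Measurable H) :
    (∫⁻ p in {p : ℝ × ℝ | p.1 ∈ Set.Icc (0 : ℝ) 1 ∧ p.2 ∈ Set.Icc (0 : ℝ) 1 ∧ p.1 < p.2},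
      H (p.2 - p.1)) ≤ ∫⁻ s, H s := by
  calc _ ≤ ∫⁻ p in Set.Icc (0 : ℝ) 1 ×ˢ (Set.univ : Set ℝ), H (p.2 - p.1) :=
        lintegral_mono_set (fun p hp => ⟨hp.1, trivial⟩)
    _ = ∫⁻ t in Set.Icc (0 : ℝ) 1, ∫⁻ t', H (t' - t) := by
        rw [Measure.volume_eq_prod, ← Measure.prod_restrict, Measure.restrict_univ,
          lintegral_prod _ (by fun_prop)]
    _ = ∫⁻ s, H s := by
        simp_rw [lintegral_sub_right_eq_self]
        simp

/-- Let `d ≥ 4` and `f : ℝ → [0,∞)` measurable with `∫ f² e^{-x²/2} dx < ∞`.  Then, as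
`u → 0` in `ℝ^d \ {0}`,
`∫_{Δ_2} p^d_{t_2-t_1}(u) (∫ f(x) p^1_{t_2-t_1}(x) dx) dt_1 dt_2 = O(‖u‖^{-(d-3/2)})`:
there are `C > 0`, `δ > 0` such that the double integral is at most `C ‖u‖^{3/2-d}`
whenever `0 < ‖u‖ < δ`. -/
theorem stmt8 (d : ℕ) (hd : 4 ≤ d) (f : ℝ → ℝ) (hf : Measurable f) (hf0 : ∀ x, 0 ≤ f x)
    (hfi : ∫⁻ x, ENNReal.ofReal (f x ^ 2 * Real.exp (-x ^ 2 / 2)) < ⊤) :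
    ∃ C > (0 : ℝ), ∃ δ > (0 : ℝ), ∀ u : EuclideanSpace ℝ (Fin d), u ≠ 0 → ‖u‖ < δ →
      (∫⁻ p in {p : ℝ × ℝ | p.1 ∈ Set.Icc (0 : ℝ) 1 ∧ p.2 ∈ Set.Icc (0 : ℝ) 1 ∧ p.1 < p.2},
          ENNReal.ofReal (heatKernel d (p.2 - p.1) u)
            * ∫⁻ x, ENNReal.ofReal (f x * heatKernel1 (p.2 - p.1) x))
        ≤ ENNReal.ofReal (C * ‖u‖ ^ ((3 : ℝ) / 2 - d)) := by
  obtain ⟨A, hA0, hA⟩ : ∃ A : ℝ, 0 ≤ A ∧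
      ∫⁻ x, ENNReal.ofReal (f x ^ 2 * Real.exp (-x ^ 2 / 2)) = ENNReal.ofReal A :=
    ⟨_, ENNReal.toReal_nonneg, (ENNReal.ofReal_toReal hfi.ne).symm⟩
  have hd' : (4 : ℝ) ≤ d := by exact_mod_cast hd
  obtain ⟨α, hα⟩ : ∃ α : ℝ, α = d / 2 + 1 / 4 := ⟨_, rfl⟩
  have hα1 : 0 < α - 1 := by linarith
  refine ⟨(A + 1) * (2 ^ d * d.factorial + 1 / (α - 1)), by positivity, 1, one_pos, ?_⟩
  intro u hu _
  have hr : 0 < ‖u‖ := norm_pos_iff.2 hu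
  have hm := auxH_meas (2 ^ d * d.factorial) α ‖u‖
  calc _ ≤ ∫⁻ p in {p : ℝ × ℝ | p.1 ∈ Set.Icc (0 : ℝ) 1 ∧ p.2 ∈ Set.Icc (0 : ℝ) 1 ∧ p.1 < p.2},
          ENNReal.ofReal (A + 1) * auxH (2 ^ d * d.factorial) α ‖u‖ (p.2 - p.1) := by
        apply setLIntegral_mono (by fun_prop)
        rintro p ⟨h1, h2, h3⟩
        have hs : 0 < p.2 - p.1 := by linarith
        have hs1 : p.2 - p.1 ≤ 1 := by linarith [h1.1, h2.2]
        generalize p.2 - p.1 = s at hs hs1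
        have hq : 0 < 2 * Real.pi * s := by positivity
        calc _ ≤ ENNReal.ofReal (heatKernel d s u)
              * ENNReal.ofReal ((A + 1) * (2 * Real.pi * s) ^ (-(1 / 4) : ℝ)) := by
              gcongr
              exact aux_inner f hf hf0 s hs hs1 A hA0 hA
          _ = ENNReal.ofReal (A + 1) *
              ENNReal.ofReal ((2 * Real.pi * s) ^ (-α) * Real.exp (-‖u‖ ^ 2 / (2 * s))) := by
              unfold heatKernel
              rw [← ENNReal.ofReal_mul (by positivity), ← ENNReal.ofReal_mul (by positivity)]
              congr 1
              rw [show -α = -(d : ℝ) / 2 + -(1 / 4) by rw [hα]; ring, Real.rpow_add hq]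
              ring
          _ ≤ _ := by
              gcongr
              exact aux_pt d α ‖u‖ s (by linarith) (by linarith) hr hs
    _ ≤ ∫⁻ s, ENNReal.ofReal (A + 1) * auxH (2 ^ d * d.factorial) α ‖u‖ s :=
        aux_outer (fun s => ENNReal.ofReal (A + 1) * auxH (2 ^ d * d.factorial) α ‖u‖ s)
          (by fun_prop)
    _ = _ := by
        rw [lintegral_const_mul _ hm, auxH_int _ _ _ (by positivity) (by linarith) hr,
          ← ENNReal.ofReal_mul (by positivity), mul_assoc]
        congr 4
        rw [hα]; ring
end
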